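/- Let a, b, r be real numbers with a > 0, b > 0 and r > 0, and define δ = -3*b^2*a^2*r^2 + r^2*a^2*(a*b*r)^(2/3) + 3*(a*b*r)^(1/3)*b^3*a*r - b^4*(a*b*r)^(2/3), where the fractional powers denote real powers of the positive real number a*b*r. Then δ = 0 if and only if r = b^2/a. (This identifies the critical offset r_crit = b^2/a for the ellipse as the unique positive zero of δ.) -/

import Mathlib

theorem ellipse_delta_zero_iff_critical_offset (a b r : ℝ) (ha : 0 < a) (hb : 0 < b)
    (hr : 0 < r) :
    -3*b^2*a^2*r^2 + r^2*a^2*(a*b*r)^((2:ℝ)/3) + 3*(a*b*r)^((1:ℝ)/3)*b^3*a*r -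
        b^4*(a*b*r)^((2:ℝ)/3) = 0
      ↔ r = b^2/a := by
  have hp : 0 < a*b*r := by positivity
  have h2 : (a*b*r)^((2:ℝ)/3) = ((a*b*r)^((1:ℝ)/3))^2 := by
    rw [← Real.rpow_natCast, ← Real.rpow_mul hp.le]; norm_num
  have h3 : ((a*b*r)^((1:ℝ)/3))^3 = a*b*r := by
    rw [← Real.rpow_natCast, ← Real.rpow_mul hp.le]; norm_num
  have ht : 0 < (a*b*r)^((1:ℝ)/3) := Real.rpow_pos_of_pos hp _
  rw [h2]
  generalize (a*b*r)^((1:ℝ)/3) = t at h3 ht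
  have hs : a * r = t^3 / b := by rw [h3]; field_simp
  have key : -3*b^2*a^2*r^2 + r^2*a^2*t^2 + 3*t*b^3*a*r - b^4*t^2
      = t^2/b^2 * (t^2-b^2)^3 := by
    have : -3*b^2*a^2*r^2 + r^2*a^2*t^2 + 3*t*b^3*a*r - b^4*t^2
      = -3*b^2*(a*r)^2 + (a*r)^2*t^2 + 3*t*b^3*(a*r) - b^4*t^2 := by ring
    rw [this, hs]; field_simp; ring
  rw [key, eq_div_iff ha.ne', mul_comm r a, hs, div_eq_iff hb.ne']
  constructor
  · intro h
    have h1 : t^2/b^2 ≠ 0 := by positivity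
    have h4 : t^2 - b^2 = 0 := by
      have := (mul_eq_zero.mp h).resolve_left h1
      exact pow_eq_zero_iff (by norm_num) |>.mp this
    have : t = b := (pow_left_inj₀ ht.le hb.le two_ne_zero).mp (by linarith)
    subst this; ring
  · intro h
    have : t = b := (pow_left_inj₀ ht.le hb.le three_ne_zero).mp (by linarith)
    subst this; ring
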